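/- Let $p \geq 5$ be a prime and let $P = C_p \wr C_p$ be the regular wreath product of the cyclic group of order $p$ with itself. Then there exist faithful irreducible complex characters $\varphi, \psi$ of $P$ such that the product $\varphi\psi$ has exactly $p-1$ distinct irreducible constituents. -/

import Mathlib

/-!  Basic set-up: the regular wreath product `C_p ≀ C_p` and elementary character theory. -/

/-- The additive automorphism of `ZMod p → ZMod p` rotating the coordinates by `k`. -/
def rotAdd (p : ℕ) (k : ZMod p) : (ZMod p → ZMod p) ≃+ (ZMod p → ZMod p) where
  toFun f := fun i => f (i + k)
  invFun f := fun i => f (i - k)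
  left_inv f := funext fun i => by simp
  right_inv f := funext fun i => by simp
  map_add' f g := rfl

/-- The action of `C_p` on the base group `C_p^p` by cyclically permuting the coordinates. -/
def rotHom (p : ℕ) :
    Multiplicative (ZMod p) →* MulAut (Multiplicative (ZMod p → ZMod p)) where
  toFun k := AddEquiv.toMultiplicative (rotAdd p (Multiplicative.toAdd k))
  map_one' := MulEquiv.ext fun f =>
    congrArg Multiplicative.ofAdd (funext fun i =>
      congrArg (Multiplicative.toAdd f) (add_zero i))
  map_mul' k l := MulEquiv.ext fun f =>
    congrArg Multiplicative.ofAdd (funext fun i =>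
      congrArg (Multiplicative.toAdd f)
        (add_assoc i (Multiplicative.toAdd k) (Multiplicative.toAdd l)).symm)

/-- The regular wreath product `P = C_p ≀ C_p`: the semidirect product of the base group
`A = C_p^p` with `C_p` acting by cyclically permuting the coordinates. -/
abbrev Wr (p : ℕ) : Type :=
  Multiplicative (ZMod p → ZMod p) ⋊[rotHom p] Multiplicative (ZMod p)

noncomputable instance (p : ℕ) [NeZero p] : Fintype (Wr p) :=
  Fintype.ofEquiv (Multiplicative (ZMod p → ZMod p) × Multiplicative (ZMod p))
    { toFun := fun x => ⟨x.1, x.2⟩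
      invFun := fun g => (g.left, g.right)
      left_inv := fun _ => rfl
      right_inv := fun _ => rfl }

section CharacterTheory

variable (G : Type*) [Group G]

/-- A function `G → ℂ` is a (complex) character if it is the pointwise trace of some
finite-dimensional complex matrix representation of `G`. -/
def IsCharacter (χ : G → ℂ) : Prop :=
  ∃ (n : ℕ) (ρ : G →* Matrix.GeneralLinearGroup (Fin n) ℂ),
    ∀ g : G, χ g = Matrix.trace (ρ g : Matrix (Fin n) (Fin n) ℂ)

variable [Fintype G]

/-- The standard inner product of class functions on a finite group. -/
noncomputable def charInner (χ ψ : G → ℂ) : ℂ :=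
  (Fintype.card G : ℂ)⁻¹ * ∑ g : G, χ g * (starRingEnd ℂ) (ψ g)

/-- A character is irreducible iff it has norm one with respect to the standard
inner product of class functions. -/
def IsIrreducibleCharacter (χ : G → ℂ) : Prop :=
  IsCharacter G χ ∧ charInner G χ χ = 1

/-- A character is faithful if its kernel `{g | χ g = χ 1}` is trivial. -/
def IsFaithfulCharacter (χ : G → ℂ) : Prop :=
  ∀ g : G, χ g = χ 1 → g = 1

/-- The number of distinct irreducible constituents of a character, i.e. the number of
irreducible characters occurring in it with nonzero multiplicity. -/
noncomputable def numConstituents (χ : G → ℂ) : ℕ :=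
  Set.ncard {θ : G → ℂ | IsIrreducibleCharacter G θ ∧ charInner G χ θ ≠ 0}

end CharacterTheory

section Wreath

variable (p : ℕ) [NeZero p]

/-- The character of the wreath product `C_p ≀ C_p` induced from a character `ν` of the
base group `A = C_p^p`, given by the usual induced-character formula. -/
noncomputable def inducedFromBase (ν : Multiplicative (ZMod p → ZMod p) → ℂ) :
    Wr p → ℂ := fun g =>
  (Fintype.card (Multiplicative (ZMod p → ZMod p)) : ℂ)⁻¹ *
    ∑ x : Wr p,
      if (x * g * x⁻¹).right = 1 then ν ((x * g * x⁻¹).left) else 0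

/-- The linear character `λ^{i₁} × ⋯ × λ^{iₚ}` of the base group `A = C_p^p` attached to a
character `λ` of `C_p` and the `p`-tuple `t = (i₁, …, iₚ)` of exponents modulo `p`. -/
noncomputable def tupleChar (lam : Multiplicative (ZMod p) → ℂ) (t : ZMod p → ZMod p) :
    Multiplicative (ZMod p → ZMod p) → ℂ := fun f =>
  ∏ j : ZMod p, (lam (Multiplicative.ofAdd (Multiplicative.toAdd f j))) ^ (t j).val

/-- The embedding of `C_p` as the diagonal of the base group `C_p^p`. -/
def constHom : Multiplicative (ZMod p) →* Multiplicative (ZMod p → ZMod p) where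
  toFun x := Multiplicative.ofAdd fun _ => Multiplicative.toAdd x
  map_one' := rfl
  map_mul' _ _ := rfl

/-- The diagonal subgroup `{(x, …, x) ∣ x ∈ C_p}` of the base group, inside `C_p ≀ C_p`. -/
def diagonalSubgroup : Subgroup (Wr p) :=
  (SemidirectProduct.inl.comp (constHom p)).range

end Wreath

section Helpers

open Matrix ComplexOrder in
theorem trace_inv_conj {G : Type} [Group G] [Fintype G] {n : ℕ}
    (ρ : G →* Matrix.GeneralLinearGroup (Fin n) ℂ) (g : G) :
    Matrix.trace (ρ g⁻¹ : Matrix (Fin n) (Fin n) ℂ)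
      = (starRingEnd ℂ) (Matrix.trace (ρ g : Matrix (Fin n) (Fin n) ℂ)) := by
  classical
  let M : G → Matrix (Fin n) (Fin n) ℂ := fun g => (ρ g : Matrix (Fin n) (Fin n) ℂ)
  have hM : ∀ a b, M (a * b) = M a * M b := fun a b => by simp [M]
  have hM1 : M 1 = 1 := by simp [M]
  let H : Matrix (Fin n) (Fin n) ℂ := ∑ x, (M x)ᴴ * M x
  have hpd : H.PosDef := by
    have h1 : H = (M 1)ᴴ * M 1 + ∑ x ∈ Finset.univ.erase 1, (M x)ᴴ * M x :=
      (Finset.add_sum_erase _ _ (Finset.mem_univ _)).symm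
    rw [h1, hM1]
    refine Matrix.PosDef.add_posSemidef ?_ ?_
    · simpa using Matrix.PosDef.one
    · exact Matrix.posSemidef_sum _ fun x _ => Matrix.posSemidef_conjTranspose_mul_self _
  have hinv : (M g)ᴴ * H * M g = H := by
    simp only [H, Finset.mul_sum, Finset.sum_mul]
    refine Fintype.sum_equiv (Equiv.mulRight g) _ _ fun x => ?_
    simp [hM, Matrix.mul_assoc]
  have hu : IsUnit H.det := (Matrix.isUnit_iff_isUnit_det _).1 hpd.isUnit
  have hgg : M g * M g⁻¹ = 1 := by rw [← hM]; simp [hM1]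
  have h2 : M g⁻¹ = H⁻¹ * (M g)ᴴ * H := by
    have : H * M g⁻¹ = (M g)ᴴ * H := by
      calc H * M g⁻¹ = (M g)ᴴ * H * M g * M g⁻¹ := by rw [hinv]
        _ = _ := by rw [Matrix.mul_assoc, hgg, Matrix.mul_one]
    rw [Matrix.mul_assoc, ← this, ← Matrix.mul_assoc, Matrix.nonsing_inv_mul _ hu, Matrix.one_mul]
  change trace (M g⁻¹) = star (trace (M g))
  rw [h2, Matrix.trace_mul_comm, ← Matrix.mul_assoc, Matrix.mul_nonsing_inv _ hu, Matrix.one_mul,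
    Matrix.trace_conjTranspose]

theorem irr_unique {G : Type} [Group G] [Fintype G] {χ θ : G → ℂ}
    (hχ : IsIrreducibleCharacter G χ) (hθ : IsIrreducibleCharacter G θ)
    (h : charInner G χ θ ≠ 0) : χ = θ := by
  have key : ∀ χ : G → ℂ, IsCharacter G χ → ∃ V : FDRep ℂ G, V.character = χ ∧
      ∀ g, (starRingEnd ℂ) (χ g) = χ g⁻¹ := by
    rintro χ ⟨n, ρ, hρ⟩
    let r : G →* ((Fin n → ℂ) →ₗ[ℂ] (Fin n → ℂ)) :=
      (Matrix.toLinAlgEquiv' : Matrix (Fin n) (Fin n) ℂ ≃ₐ[ℂ] _).toMonoidHom.comp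
        ((Units.coeHom _).comp ρ)
    refine ⟨FDRep.of r, ?_, ?_⟩
    · funext g
      rw [hρ]
      change LinearMap.trace ℂ (Fin n → ℂ) (Matrix.toLin' (ρ g : Matrix (Fin n) (Fin n) ℂ)) = _
      exact Matrix.trace_toLin'_eq _
    · intro g
      rw [hρ, hρ, trace_inv_conj]
  obtain ⟨V, hV, hVc⟩ := key χ hχ.1
  obtain ⟨W, hW, hWc⟩ := key θ hθ.1
  have hcard : (Fintype.card G : ℂ) ≠ 0 := by simp
  have hV1 : CategoryTheory.Simple V := by
    rw [FDRep.simple_iff_char_is_norm_one, hV]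
    have := hχ.2
    simp only [charInner, hVc] at this
    rw [inv_mul_eq_one₀ hcard] at this
    rw [← this]; simp
  have hW1 : CategoryTheory.Simple W := by
    rw [FDRep.simple_iff_char_is_norm_one, hW]
    have := hθ.2
    simp only [charInner, hWc] at this
    rw [inv_mul_eq_one₀ hcard] at this
    rw [← this]; simp
  have : Invertible (Nat.card G : ℂ) := invertibleOfNonzero (by simp)
  have ho := FDRep.char_orthonormal V W
  rw [hV, hW] at ho
  simp only [charInner, hWc, ← Nat.card_eq_fintype_card] at h
  rw [ho] at h
  have : Nonempty (V ≅ W) := by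
    by_contra hc
    simp [hc] at h
  rw [← hV, ← hW, FDRep.char_iso this.some]

variable {p : ℕ} [Fact p.Prime]

/-- value of the character attached to `c` on the rotation of `f` by `i`. -/
noncomputable def ev (c : ZMod p → ZMod p) (i : ZMod p) (f : ZMod p → ZMod p) : ℂ :=
  ZMod.stdAddChar (∑ x, c x * f (x + i))

/-- the induced character. -/
noncomputable def ind (c : ZMod p → ZMod p) (g : Wr p) : ℂ :=
  if g.right = 1 then ∑ i, ev c i (Multiplicative.toAdd g.left) else 0

/-- monomial matrices. -/
noncomputable def mono (c : ZMod p → ZMod p) (g : Wr p) : Matrix (ZMod p) (ZMod p) ℂ :=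
  fun i j => if j = i + Multiplicative.toAdd g.right then ev c i (Multiplicative.toAdd g.left) else 0

theorem ev_add (c i) (f f' : ZMod p → ZMod p) : ev c i (f + f') = ev c i f * ev c i f' := by
  simp only [ev, ← AddChar.map_add_eq_mul, ← Finset.sum_add_distrib, Pi.add_apply, mul_add]

theorem ev_zero (c : ZMod p → ZMod p) (i) : ev c i 0 = 1 := by
  simp [ev]

theorem mono_one (c : ZMod p → ZMod p) : mono c 1 = 1 := by
  ext i j
  simp [mono, Matrix.one_apply, ev_zero, eq_comm]

theorem mono_mul (c : ZMod p → ZMod p) (g h : Wr p) : mono c (g * h) = mono c g * mono c h := by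
  ext i j
  rw [Matrix.mul_apply, Finset.sum_eq_single (i + Multiplicative.toAdd g.right)]
  · simp only [mono, SemidirectProduct.mul_right, SemidirectProduct.mul_left, toAdd_mul, ev_add,
      if_true, add_assoc, mul_ite, mul_zero]
    have h1 : ev c i (Multiplicative.toAdd ((rotHom p) g.right h.left)) =
        ev c (i + Multiplicative.toAdd g.right) (Multiplicative.toAdd h.left) := by
      simp only [ev]
      refine congrArg _ (Finset.sum_congr rfl fun x _ => ?_)
      congr 1
      change Multiplicative.toAdd h.left (x + i + _) = _
      rw [add_assoc]
    rw [h1]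
  · intro b _ hb
    simp [mono, hb]
  · simp

theorem ind_isCharacter (c : ZMod p → ZMod p) : IsCharacter (Wr p) (ind c) := by
  let e : ZMod p ≃ Fin p := Fintype.equivFinOfCardEq (ZMod.card p)
  let m : Wr p →* Matrix (Fin p) (Fin p) ℂ :=
    { toFun := fun g => Matrix.reindexAlgEquiv ℂ ℂ e (mono c g)
      map_one' := by rw [mono_one, map_one]
      map_mul' := fun g h => by rw [mono_mul, map_mul] }
  refine ⟨p, m.toHomUnits, fun g => ?_⟩
  change ind c g = Matrix.trace (Matrix.reindexAlgEquiv ℂ ℂ e (mono c g))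
  have : Matrix.trace (Matrix.reindexAlgEquiv ℂ ℂ e (mono c g)) = Matrix.trace (mono c g) := by
    simp only [Matrix.trace, Matrix.diag]
    exact Fintype.sum_equiv e.symm _ _ fun x => by simp
  rw [this, ind]
  simp only [Matrix.trace, Matrix.diag, mono]
  split_ifs with h
  · simp [h]
  · have : ¬ Multiplicative.toAdd g.right = 0 := h
    simp [this]

/-- shift of tuples -/
def shf (m : ZMod p) (c : ZMod p → ZMod p) : ZMod p → ZMod p := fun x => c (x - m)

theorem ev_shf (c : ZMod p → ZMod p) (i j f) : ev (shf j c) i f = ev c (j + i) f := by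
  simp only [ev, shf]
  congr 1
  exact Fintype.sum_equiv (Equiv.subRight j) _ _ fun x => by simp [← add_assoc]

theorem ev_eq (c : ZMod p → ZMod p) (i f) : ev c i f = ev (shf i c) 0 f := by
  rw [ev_shf, add_zero]

theorem ev_mul (c d : ZMod p → ZMod p) (i f) : ev (c + d) i f = ev c i f * ev d i f := by
  simp only [ev, ← AddChar.map_add_eq_mul, ← Finset.sum_add_distrib, Pi.add_apply, add_mul]

theorem ev_conj (c : ZMod p → ZMod p) (i f) :
    (starRingEnd ℂ) (ev c i f) = ev (-c) i f := by
  simp only [ev, Pi.neg_apply, neg_mul, Finset.sum_neg_distrib, AddChar.map_neg_eq_conj]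

theorem ind_shf (c : ZMod p → ZMod p) (m) : ind (shf m c) = ind c := by
  funext g
  simp only [ind, ev_shf]
  congr 1
  exact Fintype.sum_equiv (Equiv.addLeft m) _ _ fun x => by simp

theorem ind_mul (a b : ZMod p → ZMod p) (g : Wr p) :
    ind a g * ind b g = ∑ k, ind (a + shf k b) g := by
  simp only [ind]
  split_ifs with h
  · simp only [ev_mul, ev_shf, Finset.sum_mul_sum]
    rw [Finset.sum_comm (s := Finset.univ (α := ZMod p)) (f := fun k i =>
      ev a i (Multiplicative.toAdd g.left) * ev b (k + i) (Multiplicative.toAdd g.left))]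
    refine Finset.sum_congr rfl fun i _ => ?_
    exact Fintype.sum_equiv (Equiv.subRight i) _ _ fun x => by simp
  · simp

theorem ev_sum (c : ZMod p → ZMod p) :
    ∑ f, ev c 0 f = if c = 0 then (p : ℂ) ^ p else 0 := by
  let ψ : AddChar (ZMod p → ZMod p) ℂ :=
    { toFun := ev c 0, map_zero_eq_one' := ev_zero c 0, map_add_eq_mul' := ev_add c 0 }
  classical
  have h := AddChar.sum_eq_ite ψ
  change ∑ f, ev c 0 f = _ at h
  rw [h]
  have : ψ = 0 ↔ c = 0 := by
    constructor
    · intro h0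
      funext y
      have h1 : ψ (Pi.single y 1) = 1 := by rw [h0]; rfl
      change ev c 0 (Pi.single y 1) = 1 at h1
      simp only [ev, add_zero, Pi.single_apply, mul_ite, mul_one, mul_zero, Finset.sum_ite_eq',
        Finset.mem_univ, if_true, Finset.sum_ite_eq] at h1
      exact ZMod.injective_stdAddChar (h1.trans (AddChar.map_zero_eq_one _).symm)
    · rintro rfl
      ext f
      change ev 0 0 f = 1
      simp [ev]
  simp [this]

theorem sum_wr (F : Wr p → ℂ) : ∑ g, F g =
    ∑ f : ZMod p → ZMod p, ∑ s : ZMod p, F ⟨Multiplicative.ofAdd f, Multiplicative.ofAdd s⟩ := by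
  rw [← Fintype.sum_prod_type']
  exact (Fintype.sum_equiv (⟨fun x => ⟨x.1, x.2⟩, fun g => (g.left, g.right), fun _ => rfl,
    fun _ => rfl⟩ : (ZMod p → ZMod p) × ZMod p ≃ Wr p) _ _ fun x => rfl).symm

theorem card_wr : (Fintype.card (Wr p) : ℂ) = (p : ℂ) ^ p * p := by
  have := sum_wr (p := p) (fun _ => 1)
  simpa using this

theorem inner_ind (c d : ZMod p → ZMod p) :
    charInner (Wr p) (ind c) (ind d) =
      (p : ℂ)⁻¹ * ∑ i, ∑ j, if shf i c = shf j d then 1 else 0 := by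
  have hp0 : (p : ℂ) ≠ 0 := by exact_mod_cast (Fact.out : p.Prime).ne_zero
  have h1 : ∑ g : Wr p, ind c g * (starRingEnd ℂ) (ind d g)
      = ∑ i, ∑ j, ∑ f, ev (shf i c - shf j d) 0 f := by
    rw [sum_wr]
    have : ∀ f : ZMod p → ZMod p, ∑ s : ZMod p,
        ind c ⟨Multiplicative.ofAdd f, Multiplicative.ofAdd s⟩ *
        (starRingEnd ℂ) (ind d ⟨Multiplicative.ofAdd f, Multiplicative.ofAdd s⟩) =
        ∑ i, ∑ j, ev (shf i c - shf j d) 0 f := by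
      intro f
      rw [Finset.sum_eq_single 0]
      · simp only [ind, ofAdd_zero, if_true, toAdd_ofAdd, map_sum, Finset.sum_mul_sum]
        refine Finset.sum_congr rfl fun i _ => Finset.sum_congr rfl fun j _ => ?_
        rw [ev_conj, ev_eq c, ev_eq (-d), ← ev_mul]
        congr 1
        funext x
        simp [shf, sub_eq_add_neg]
      · intro s _ hs
        simp [ind, hs]
      · simp
    simp only [this]
    rw [Finset.sum_comm]
    exact Finset.sum_congr rfl fun i _ => Finset.sum_comm
  rw [charInner, h1, card_wr]
  simp only [ev_sum, sub_eq_zero, Finset.mul_sum]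
  refine Finset.sum_congr rfl fun i _ => Finset.sum_congr rfl fun j _ => ?_
  split_ifs
  · field_simp
  · simp

theorem shf_eq_iff (c d : ZMod p → ZMod p) (i j) : shf i c = shf j d ↔ c = shf (j - i) d := by
  simp only [funext_iff, shf]
  constructor
  · intro h x
    have := h (x + i)
    simpa [add_sub_assoc, sub_eq_add_neg, add_assoc, add_comm, add_left_comm] using this
  · intro h x
    rw [h]; congr 1; ring

theorem shf_self_const (c : ZMod p → ZMod p) (m) (hm : m ≠ 0) (h : c = shf m c) (x y) :
    c x = c y := by
  have h1 : ∀ x, c (x + m) = c x := fun x => by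
    conv_lhs => rw [h]
    simp [shf]
  have h2 : ∀ (n : ℕ) x, c (x + n * m) = c x := by
    intro n
    induction n with
    | zero => simp
    | succ n ih =>
      intro x
      rw [← ih x, ← h1 (x + n * m)]
      congr 1; push_cast; ring
  have := h2 (((y - x) / m).val) x
  rw [ZMod.natCast_zmod_val, div_mul_cancel₀ _ hm] at this
  rw [← this]; congr 1; ring

theorem ind_irr (c : ZMod p → ZMod p) (x y) (hc : c x ≠ c y) :
    IsIrreducibleCharacter (Wr p) (ind c) := by
  have hp0 : (p : ℂ) ≠ 0 := by exact_mod_cast (Fact.out : p.Prime).ne_zero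
  refine ⟨ind_isCharacter c, ?_⟩
  rw [inner_ind]
  have : ∀ i j : ZMod p, shf i c = shf j c ↔ i = j := by
    intro i j
    constructor
    · intro h
      rw [shf_eq_iff] at h
      by_contra hij
      exact hc (shf_self_const c _ (sub_ne_zero.2 (Ne.symm hij)) h x y)
    · rintro rfl; rfl
  simp [this, hp0]

theorem ind_ne (c d : ZMod p → ZMod p) (x y) (hc : c x ≠ c y) (h : ind c = ind d) :
    ∃ m, c = shf m d := by
  by_contra! hn
  have h1 := (ind_irr c x y hc).2
  conv at h1 => lhs; rw [h]
  rw [← h] at h1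
  have h2 := inner_ind c d
  rw [← h, h1] at h2
  simp [shf_eq_iff, hn] at h2

theorem ind_faithful (c : ZMod p → ZMod p)
    (hc : ∀ f : ZMod p → ZMod p, (∀ i, ∑ x, c x * f (x + i) = 0) → f = 0) :
    IsFaithfulCharacter (Wr p) (ind c) := by
  have hp0 : (p : ℂ) ≠ 0 := by exact_mod_cast (Fact.out : p.Prime).ne_zero
  intro g hg
  have h1 : ind c 1 = p := by simp [ind, ev_zero]
  rw [h1, ind] at hg
  split_ifs at hg with hr
  · have hl : Multiplicative.toAdd g.left = 0 := by
      apply hc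
      intro i
      set f := Multiplicative.toAdd g.left
      have hn : ∀ i, ‖ev c i f‖ = 1 := fun i => by simp [ev]
      have hle : ∀ i, (ev c i f).re ≤ 1 := fun i => (Complex.re_le_norm _).trans (hn i).le
      have hs : ∑ i, (ev c i f).re = ∑ i : ZMod p, (1 : ℝ) := by
        rw [← Complex.re_sum, hg]; simp
      have h3 := (Finset.sum_eq_sum_iff_of_le (fun i _ => hle i)).1 hs i (Finset.mem_univ _)
      have h4 : ev c i f = 1 := by
        have h5 := hn i
        have h6 : (ev c i f).im = 0 := by
          have := Complex.sq_norm (ev c i f)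
          rw [h5, Complex.normSq_apply, h3] at this
          nlinarith
        exact Complex.ext (by simp [h3]) (by simp [h6])
      exact ZMod.injective_stdAddChar (h4.trans (AddChar.map_zero_eq_one _).symm)
    exact SemidirectProduct.ext hl hr
  · exact absurd hg.symm hp0

/-- the delta tuple -/
def dl (k : ZMod p) : ZMod p → ZMod p := fun x => if x = k then 1 else 0

theorem shf_dl (k : ZMod p) : shf k (dl 0) = dl k := by
  funext x; simp [shf, dl, sub_eq_zero]

theorem two_ne (hp : 5 ≤ p) : (2 : ZMod p) ≠ 0 := by
  intro h
  have : ((2 : ℕ) : ZMod p) = 0 := by exact_mod_cast h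
  rw [ZMod.natCast_eq_zero_iff] at this
  have := Nat.le_of_dvd (by norm_num) this
  omega

/-- the tuples occurring in the product -/
def ck (k : ZMod p) : ZMod p → ZMod p := fun x =>
  -(if x = 0 then 1 else 0) - (if x = 1 then 1 else 0) + (if x = k then 1 else 0)

theorem comb (hp : 5 ≤ p) (k l m : ZMod p) (hk : k ≠ 0) (hl : l ≠ 0)
    (h : ck k = shf m (ck l)) : k = l := by
  have h2 := two_ne hp
  have h' : ∀ x, ck k x = ck l (x - m) := fun x => congrFun h x
  have e0 := h' 0
  have e1 := h' 1
  have em := h' m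
  have em1 := h' (m + 1)
  have ek := h' k
  simp only [ck] at e0 e1 em em1 ek
  by_cases hk1 : k = 1
  · subst hk1
    have hm : m = 0 := by grind
    subst hm
    grind
  by_cases hl1 : l = 1
  · subst hl1
    have hm : m = 0 := by grind
    subst hm
    grind
  have hm : m = 0 := by grind
  subst hm
  grind

theorem ck_irr (hp : 5 ≤ p) (k : ZMod p) : IsIrreducibleCharacter (Wr p) (ind (ck k)) := by
  have h2 := two_ne hp
  by_cases hk : k = 0
  · exact ind_irr _ 0 1 (by simp [ck, hk])
  by_cases hk1 : k = 1
  · exact ind_irr _ 0 1 (by simp [ck, hk1])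
  refine ind_irr _ 0 k ?_
  simp only [ck]
  grind

theorem ck_inj (hp : 5 ≤ p) (k l : ZMod p) (hk : k ≠ 0) (hl : l ≠ 0)
    (h : ind (ck k) = ind (ck l)) : k = l := by
  have h2 := two_ne hp
  have : ∃ x y, ck k x ≠ ck k y := by
    by_cases hk1 : k = 1
    · exact ⟨0, 1, by simp [ck, hk1]⟩
    refine ⟨0, k, ?_⟩
    simp only [ck]
    grind
  obtain ⟨x, y, hxy⟩ := this
  obtain ⟨m, hm⟩ := ind_ne _ _ x y hxy h
  exact comb hp k l m hk hl hm

theorem ck_zero_one : ind (ck (0 : ZMod p)) = ind (ck 1) := by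
  rw [← ind_shf (ck 1) 1]
  congr 1
  funext x
  simp [ck, shf, sub_eq_zero]
  ring

theorem charInner_sum {G ι : Type} [Group G] [Fintype G] [Fintype ι] (F : ι → G → ℂ) (θ : G → ℂ) :
    charInner G (fun g => ∑ k, F k g) θ = ∑ k, charInner G (F k) θ := by
  simp only [charInner, Finset.sum_mul, ← Finset.mul_sum]
  rw [Finset.sum_comm]

theorem dl_faithful : IsFaithfulCharacter (Wr p) (ind (dl (0 : ZMod p))) := by
  refine ind_faithful _ fun f hf => ?_
  funext i
  simpa [dl] using hf i

theorem a_faithful (hp : 5 ≤ p) :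
    IsFaithfulCharacter (Wr p) (ind (-dl (0 : ZMod p) - dl 1)) := by
  refine ind_faithful _ fun f hf => ?_
  have h1 : ∀ i, f (i + 1) = - f i := by
    intro i
    have := hf i
    simp [dl, sub_mul, Finset.sum_sub_distrib] at this
    rw [add_comm i 1]
    linear_combination -this
  have h2 : ∀ (n : ℕ) i, f (i + n) = (-1) ^ n * f i := by
    intro n
    induction n with
    | zero => simp
    | succ n ih =>
      intro i
      push_cast
      rw [← add_assoc, h1, ih]
      ring
  funext i
  have h3 := h2 p i
  have hodd : Odd p := (Fact.out : p.Prime).odd_of_ne_two (by omega)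
  rw [hodd.neg_one_pow, CharP.cast_eq_zero, add_zero] at h3
  have h4 : 2 * f i = 0 := by linear_combination h3
  exact (mul_eq_zero.1 h4).resolve_left (two_ne hp)

end Helpers

/-- For a prime `p ≥ 5` and `P = C_p ≀ C_p`, there exist faithful
irreducible complex characters `φ, ψ` of `P` such that the product `φψ` has exactly
`p - 1` distinct irreducible constituents. -/
theorem exists_faithful_irreducible_product_with_p_sub_one_constituents
    (p : ℕ) [Fact p.Prime] (hp : 5 ≤ p) :
    ∃ φ ψ : Wr p → ℂ,
      IsIrreducibleCharacter (Wr p) φ ∧ IsFaithfulCharacter (Wr p) φ ∧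
      IsIrreducibleCharacter (Wr p) ψ ∧ IsFaithfulCharacter (Wr p) ψ ∧
      numConstituents (Wr p) (fun g => φ g * ψ g) = p - 1 := by
  refine ⟨ind (-dl 0 - dl 1), ind (dl 0), ?_, a_faithful hp, ?_, dl_faithful, ?_⟩
  · have h2 := two_ne hp
    refine ind_irr _ 0 2 ?_
    simp only [dl, Pi.sub_apply, Pi.neg_apply]
    have : (2 : ZMod p) ≠ 1 := fun h => one_ne_zero (α := ZMod p) (by linear_combination h)
    simp [h2, this]
  · exact ind_irr _ 0 1 (by simp [dl])
  have hprod : (fun g => ind (-dl 0 - dl 1) g * ind (dl (0 : ZMod p)) g) =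
      fun g => ∑ k, ind (ck k) g := by
    funext g
    rw [ind_mul]
    refine Finset.sum_congr rfl fun k _ => ?_
    rw [shf_dl]
    rfl
  have hset : {θ : Wr p → ℂ | IsIrreducibleCharacter (Wr p) θ ∧
      charInner (Wr p) (fun g => ∑ k, ind (ck k) g) θ ≠ 0} =
      (fun k => ind (ck k)) '' ((Finset.univ.erase (0 : ZMod p) : Finset (ZMod p)) : Set _) := by
    ext θ
    simp only [Set.mem_ofPred_eq, charInner_sum]
    constructor
    · rintro ⟨hθ, hne⟩
      obtain ⟨k, -, hk⟩ := Finset.exists_ne_zero_of_sum_ne_zero hne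
      have hkθ := irr_unique (ck_irr hp k) hθ hk
      by_cases hk0 : k = 0
      · refine ⟨1, by simp, ?_⟩
        rw [← hkθ, hk0, ck_zero_one]
      · exact ⟨k, by simp [hk0], hkθ⟩
    · rintro ⟨k, -, rfl⟩
      refine ⟨ck_irr hp k, ?_⟩
      classical
      have h1 : ∀ l : ZMod p, charInner (Wr p) (ind (ck l)) (ind (ck k)) =
          if ind (ck l) = ind (ck k) then 1 else 0 := by
        intro l
        split_ifs with h
        · rw [h]; exact (ck_irr hp k).2
        · by_contra hc
          exact h (irr_unique (ck_irr hp l) (ck_irr hp k) hc)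
      simp only [h1, Finset.sum_boole]
      rw [Nat.cast_ne_zero, Finset.card_ne_zero]
      exact ⟨k, by simp⟩
  rw [numConstituents, hprod, hset, Set.ncard_image_of_injOn, Set.ncard_coe_finset,
    Finset.card_erase_of_mem (Finset.mem_univ _), Finset.card_univ, ZMod.card]
  intro k hk l hl h
  exact ck_inj hp k l (by simpa using hk) (by simpa using hl) h
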